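/- Let T≥2, S⊂ℝ finite, F:ℝ→[0,1], and let (θ,π,G) be true parameters of the binary choice panel model with a binary predetermined covariate, with q_{x_1}=Pr(X_1=x_1)≥0, q_0+q_1=1. Define the average partial effect Δ = Σ_{x_1∈{0,1}} q_{x_1} Σ_{α∈S}(F(θ+α)−F(α))·π_{x_1}(α). Then a real number Δ̃ lies in the identified set of Δ if and only if there exist θ̃∈Θ and functions ψ_{x_1}:{0,1}^{T−1}×{0,1}^{T−1}×S→ℝ, x_1∈{0,1}, satisfying conditions (IS1)–(IS3) of the linear-programming characterization of Θ^I at θ̃ (nonnegativity and summing to one; consistency of each period's outcome probabilities with F(θ̃x_t+α); and matching the true likelihood Q(θ,π,G)), together with Δ̃ = Σ_{α∈S}(F(θ̃+α)−F(α))·Σ_{x_1∈{0,1}} q_{x_1} Σ_{x^{2:T}∈{0,1}^{T−1}} Σ_{y^{T−1}∈{0,1}^{T−1}} ψ_{x_1}(x^{2:T},y^{T−1},α). -/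

import Mathlib

open Finset

noncomputable section

/-- Real indicator of a boolean value: `bx true = 1`, `bx false = 0`. -/
def bx (b : Bool) : ℝ := if b then 1 else 0

/-- `bpow y p = p^y (1-p)^(1-y)` for a binary outcome `y`. -/
def bpow (b : Bool) (p : ℝ) : ℝ := if b then p else 1 - p

/-- Feedback process: for each period `t` (0-based; periods `t ≥ 1` are relevant),
the probability that `X_{t+1} = 1` given the histories and the heterogeneity `α`. -/
abbrev Feedback (T : ℕ) (S : Finset ℝ) : Type :=
  (t : Fin T) → (Fin (t : ℕ) → Bool) → (Fin (t : ℕ) → Bool) → ↥S → ℝ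

/-- Restriction of a full path to the history before period `t`. -/
def restr {T : ℕ} (z : Fin T → Bool) (t : Fin T) : Fin (t : ℕ) → Bool :=
  fun i => z ⟨(i : ℕ), lt_trans i.isLt t.isLt⟩

/-- Parameter space of the T-period model. -/
abbrev ParamT (T : ℕ) (S : Finset ℝ) : Type :=
  ℝ × (Bool → ↥S → ℝ) × Feedback T S

/-- The conditional likelihood `Q_{x₁}(y^T, x^{2:T}; θ,π,G)` of the T-period binary
choice panel model with a predetermined binary covariate, written over full paths
`y x : Fin T → Bool` (conditioning covariate is `x 0`). -/
def QT (T : ℕ) [NeZero T] (F : ℝ → ℝ) (S : Finset ℝ) (p : ParamT T S)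
    (y x : Fin T → Bool) : ℝ :=
  ∑ α : ↥S,
    (∏ t : Fin T, bpow (y t) (F (p.1 * bx (x t) + ↑α))) *
    (∏ t : Fin T, if (t : ℕ) = 0 then 1 else
      bpow (x t) (p.2.2 t (restr y t) (restr x t) α)) *
    p.2.1 (x 0) α

/-- Valid heterogeneity distribution: nonnegative weights summing to one for each `x₁`. -/
def ValidPiT (S : Finset ℝ) (π : Bool → ↥S → ℝ) : Prop :=
  (∀ x1 α, 0 ≤ π x1 α) ∧ ∀ x1, ∑ α : ↥S, π x1 α = 1

/-- Valid feedback process: probabilities in `[0,1]`. -/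
def ValidGT (T : ℕ) (S : Finset ℝ) (G : Feedback T S) : Prop :=
  ∀ t yh xh α, G t yh xh α ∈ Set.Icc (0:ℝ) 1

/-- Full covariate path built from the initial covariate `x₁` and `x^{2:T}`. -/
def consPath {T : ℕ} (x1 : Bool) (xr : Fin (T - 1) → Bool) : Fin T → Bool :=
  fun t => if h : (t : ℕ) = 0 then x1 else xr ⟨(t : ℕ) - 1, by have := t.isLt; omega⟩

/-- Full outcome path built from `y^{T-1}` and the last outcome `y_T`. -/
def snocPath {T : ℕ} (yr : Fin (T - 1) → Bool) (yT : Bool) : Fin T → Bool :=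
  fun t => if h : (t : ℕ) < T - 1 then yr ⟨(t : ℕ), h⟩ else yT

/-- Conditions (IS1)–(IS3) of Proposition 1: `ψ_{x₁}(x^{2:T}, y^{T-1}, α)` matches the
true likelihood, is a valid probability mass function, and is consistent with the
parametric outcome probabilities at the candidate parameter `θ̃`. -/
def PsiFeasible (T : ℕ) [NeZero T] (hT : 2 ≤ T) (S : Finset ℝ) (F : ℝ → ℝ)
    (θ : ℝ) (π : Bool → ↥S → ℝ) (G : Feedback T S) (θt : ℝ)
    (ψ : Bool → (Fin (T - 1) → Bool) → (Fin (T - 1) → Bool) → ↥S → ℝ) : Prop :=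
  -- (IS1): ψ reproduces the true likelihood
  (∀ (x1 : Bool) (yr : Fin (T - 1) → Bool) (yT : Bool) (xr : Fin (T - 1) → Bool),
    QT T F S (θ, π, G) (snocPath yr yT) (consPath x1 xr) =
      ∑ α : ↥S, bpow yT (F (θt * bx (xr ⟨T - 2, by omega⟩) + ↑α)) * ψ x1 xr yr α) ∧
  -- (IS2): ψ is a valid probability mass function
  (∀ x1 xr yr α, 0 ≤ ψ x1 xr yr α) ∧
  (∀ x1 : Bool, ∑ xr : Fin (T - 1) → Bool, ∑ yr : Fin (T - 1) → Bool, ∑ α : ↥S,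
    ψ x1 xr yr α = 1) ∧
  -- (IS3): consistency with the outcome probabilities at θ̃ for each s ∈ {2,…,T}
  (∀ (s : ℕ) (hs2 : 2 ≤ s) (hsT : s ≤ T) (α : ↥S) (x1 : Bool)
      (xr yr : Fin (T - 1) → Bool),
    (∑ xr' ∈ Finset.univ.filter
        (fun xr' : Fin (T - 1) → Bool => ∀ i : Fin (T - 1), (i : ℕ) < s - 2 → xr' i = xr i),
      ∑ yr' ∈ Finset.univ.filter
        (fun yr' : Fin (T - 1) → Bool => ∀ i : Fin (T - 1), (i : ℕ) < s - 1 → yr' i = yr i),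
        ψ x1 xr' yr' α) =
    bpow (yr ⟨s - 2, by omega⟩) (F (θt * bx (consPath x1 xr ⟨s - 2, by omega⟩) + ↑α)) *
    (∑ xr' ∈ Finset.univ.filter
        (fun xr' : Fin (T - 1) → Bool => ∀ i : Fin (T - 1), (i : ℕ) < s - 2 → xr' i = xr i),
      ∑ yr' ∈ Finset.univ.filter
        (fun yr' : Fin (T - 1) → Bool => ∀ i : Fin (T - 1), (i : ℕ) < s - 2 → yr' i = yr i),
        ψ x1 xr' yr' α))

/-- Sum of `h` over the paths that agree with `z` before `k`. -/
def prefSum {n : ℕ} (k : ℕ) (z : Fin n → Bool) (h : (Fin n → Bool) → ℝ) : ℝ :=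
  ∑ z' ∈ Finset.univ.filter (fun z' : Fin n → Bool => ∀ i : Fin n, (i : ℕ) < k → z' i = z i), h z'

lemma prefSum_congr {n : ℕ} (k : ℕ) (z w : Fin n → Bool) (h : (Fin n → Bool) → ℝ)
    (hzw : ∀ i : Fin n, (i : ℕ) < k → z i = w i) : prefSum k z h = prefSum k w h := by
  unfold prefSum
  refine Finset.sum_congr ?_ fun _ _ => rfl
  ext z'
  simp only [Finset.mem_filter, Finset.mem_univ, true_and]
  constructor
  · intro H i hi
    rw [H i hi, hzw i hi]
  · intro H i hi
    rw [H i hi, hzw i hi]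

lemma prefSum_nonneg {n : ℕ} (k : ℕ) (z : Fin n → Bool) (h : (Fin n → Bool) → ℝ)
    (hh : ∀ z, 0 ≤ h z) : 0 ≤ prefSum k z h :=
  Finset.sum_nonneg fun _ _ => hh _

lemma prefSum_anti {n : ℕ} (k l : ℕ) (hkl : k ≤ l) (z : Fin n → Bool) (h : (Fin n → Bool) → ℝ)
    (hh : ∀ z, 0 ≤ h z) : prefSum l z h ≤ prefSum k z h := by
  unfold prefSum
  refine Finset.sum_le_sum_of_subset_of_nonneg ?_ fun _ _ _ => hh _
  intro z'
  simp only [Finset.mem_filter, Finset.mem_univ, true_and]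
  intro H i hi
  exact H i (lt_of_lt_of_le hi hkl)

lemma prefSum_full {n : ℕ} (z : Fin n → Bool) (h : (Fin n → Bool) → ℝ) :
    prefSum n z h = h z := by
  unfold prefSum
  rw [Finset.sum_eq_single z]
  · intro b hb hne
    simp only [Finset.mem_filter, Finset.mem_univ, true_and] at hb
    exact absurd (funext fun i => hb i i.isLt) hne
  · intro H
    simp at H

lemma prefSum_zero {n : ℕ} (z : Fin n → Bool) (h : (Fin n → Bool) → ℝ) :
    prefSum 0 z h = ∑ z', h z' := by
  unfold prefSum
  simp

lemma prefSum_split {n : ℕ} (k : Fin n) (z : Fin n → Bool) (h : (Fin n → Bool) → ℝ) :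
    prefSum (k : ℕ) z h = prefSum ((k : ℕ) + 1) (Function.update z k true) h +
      prefSum ((k : ℕ) + 1) (Function.update z k false) h := by
  unfold prefSum
  have key : ∀ b : Bool, (Finset.univ.filter (fun z' : Fin n → Bool =>
      ∀ i : Fin n, (i : ℕ) < (k : ℕ) + 1 → z' i = Function.update z k b i)) =
      (Finset.univ.filter (fun z' : Fin n → Bool =>
        ∀ i : Fin n, (i : ℕ) < (k : ℕ) → z' i = z i)).filter (fun z' => z' k = b) := by
    intro b
    ext z'
    simp only [Finset.mem_filter, Finset.mem_univ, true_and]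
    constructor
    · intro H
      refine ⟨fun i hi => ?_, ?_⟩
      · have := H i (by omega)
        rwa [Function.update_of_ne (by rintro rfl; omega)] at this
      · simpa using H k (by omega)
    · rintro ⟨H1, H2⟩ i hi
      by_cases hik : i = k
      · subst hik
        simpa using H2
      · rw [Function.update_of_ne hik]
        refine H1 i ?_
        have : (i : ℕ) ≠ k := fun h => hik (Fin.ext h)
        omega
  rw [key true, key false, ← Finset.sum_filter_add_sum_filter_not _ (fun z' => z' k = true)]
  simp

/-- Double prefix sum. -/
def dSum {n : ℕ} (ψ : (Fin n → Bool) → (Fin n → Bool) → ℝ) (a b : ℕ) (x y : Fin n → Bool) : ℝ :=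
  prefSum a x fun x' => prefSum b y (ψ x')

lemma dSum_congr {n : ℕ} (ψ : (Fin n → Bool) → (Fin n → Bool) → ℝ) (a b : ℕ)
    (x x' y y' : Fin n → Bool) (hx : ∀ i : Fin n, (i : ℕ) < a → x i = x' i)
    (hy : ∀ i : Fin n, (i : ℕ) < b → y i = y' i) : dSum ψ a b x y = dSum ψ a b x' y' := by
  unfold dSum
  rw [prefSum_congr a x x' _ hx]
  congr 1
  funext w
  exact prefSum_congr b y y' _ hy

lemma dSum_nonneg {n : ℕ} (ψ : (Fin n → Bool) → (Fin n → Bool) → ℝ) (hψ : ∀ x y, 0 ≤ ψ x y)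
    (a b : ℕ) (x y : Fin n → Bool) : 0 ≤ dSum ψ a b x y :=
  prefSum_nonneg _ _ _ fun _ => prefSum_nonneg _ _ _ (hψ _)

lemma dSum_anti {n : ℕ} (ψ : (Fin n → Bool) → (Fin n → Bool) → ℝ) (hψ : ∀ x y, 0 ≤ ψ x y)
    (a a' b : ℕ) (h : a ≤ a') (x y : Fin n → Bool) : dSum ψ a' b x y ≤ dSum ψ a b x y :=
  prefSum_anti _ _ h _ _ fun _ => prefSum_nonneg _ _ _ (hψ _)

lemma dSum_splitx {n : ℕ} (ψ : (Fin n → Bool) → (Fin n → Bool) → ℝ) (k : Fin n) (b : ℕ)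
    (x y : Fin n → Bool) : dSum ψ k b x y =
      dSum ψ ((k : ℕ) + 1) b (Function.update x k true) y +
      dSum ψ ((k : ℕ) + 1) b (Function.update x k false) y :=
  prefSum_split k x _

lemma dSum_splity {n : ℕ} (ψ : (Fin n → Bool) → (Fin n → Bool) → ℝ) (k : Fin n) (a : ℕ)
    (x y : Fin n → Bool) : dSum ψ a k x y =
      dSum ψ a ((k : ℕ) + 1) x (Function.update y k true) +
      dSum ψ a ((k : ℕ) + 1) x (Function.update y k false) := by
  unfold dSum
  simp only [prefSum_split k y]
  unfold prefSum
  rw [Finset.sum_add_distrib]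

lemma dSum_full {n : ℕ} (ψ : (Fin n → Bool) → (Fin n → Bool) → ℝ) (x y : Fin n → Bool) :
    dSum ψ n n x y = ψ x y := by
  unfold dSum
  rw [prefSum_full, prefSum_full]

lemma dSum_zero {n : ℕ} (ψ : (Fin n → Bool) → (Fin n → Bool) → ℝ) (x y : Fin n → Bool) :
    dSum ψ 0 0 x y = ∑ x', ∑ y', ψ x' y' := by
  unfold dSum
  rw [prefSum_zero]
  simp only [prefSum_zero]

/-- Partial product form. -/
def pProd {n : ℕ} (pf pg : Fin n → (Fin n → Bool) → (Fin n → Bool) → ℝ) (c : ℝ)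
    (a b : ℕ) (x y : Fin n → Bool) : ℝ :=
  (∏ i : Fin n, if (i : ℕ) < b then bpow (y i) (pf i x y) else 1) *
  (∏ i : Fin n, if (i : ℕ) < a then bpow (x i) (pg i x y) else 1) * c

lemma prod_step {n : ℕ} (k : Fin n) (f : Fin n → ℝ) :
    (∏ i : Fin n, if (i : ℕ) < (k : ℕ) + 1 then f i else 1) =
      f k * ∏ i : Fin n, if (i : ℕ) < (k : ℕ) then f i else 1 := by
  rw [← Finset.mul_prod_erase _ _ (Finset.mem_univ k),
    ← Finset.mul_prod_erase _ (fun i : Fin n => if (i : ℕ) < (k : ℕ) then f i else 1)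
      (Finset.mem_univ k)]
  simp only [lt_add_iff_pos_right, zero_lt_one, if_true, lt_irrefl, if_false, one_mul]
  congr 1
  refine Finset.prod_congr rfl fun i hi => ?_
  have : (i : ℕ) ≠ k := fun h => (Finset.ne_of_mem_erase hi) (Fin.ext h)
  have h2 : (i : ℕ) < (k : ℕ) + 1 ↔ (i : ℕ) < k := by omega
  simp only [h2]

lemma pProd_stepf {n : ℕ} (pf pg : Fin n → (Fin n → Bool) → (Fin n → Bool) → ℝ) (c : ℝ)
    (a : ℕ) (k : Fin n) (x y : Fin n → Bool) :
    pProd pf pg c a ((k : ℕ) + 1) x y = bpow (y k) (pf k x y) * pProd pf pg c a k x y := by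
  unfold pProd
  rw [prod_step k (fun i => bpow (y i) (pf i x y))]
  ring

lemma pProd_stepg {n : ℕ} (pf pg : Fin n → (Fin n → Bool) → (Fin n → Bool) → ℝ) (c : ℝ)
    (b : ℕ) (k : Fin n) (x y : Fin n → Bool) :
    pProd pf pg c ((k : ℕ) + 1) b x y = bpow (x k) (pg k x y) * pProd pf pg c k b x y := by
  unfold pProd
  rw [prod_step k (fun i => bpow (x i) (pg i x y))]
  ring

/-- `pf` depends on the past only, `pg` on the past and the current outcome. -/
def Adapt {n : ℕ} (pf pg : Fin n → (Fin n → Bool) → (Fin n → Bool) → ℝ) : Prop :=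
  (∀ i x x' y y', (∀ j : Fin n, j < i → x j = x' j) → (∀ j : Fin n, j < i → y j = y' j) →
    pf i x y = pf i x' y') ∧
  (∀ i x x' y y', (∀ j : Fin n, j < i → x j = x' j) → (∀ j : Fin n, j ≤ i → y j = y' j) →
    pg i x y = pg i x' y')

lemma pProd_congr {n : ℕ} (pf pg : Fin n → (Fin n → Bool) → (Fin n → Bool) → ℝ) (c : ℝ)
    (had : Adapt pf pg) (a b : ℕ) (hab : a ≤ b) (hba : b ≤ a + 1)
    (x x' y y' : Fin n → Bool) (hx : ∀ i : Fin n, (i : ℕ) < a → x i = x' i)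
    (hy : ∀ i : Fin n, (i : ℕ) < b → y i = y' i) :
    pProd pf pg c a b x y = pProd pf pg c a b x' y' := by
  unfold pProd
  congr 2
  · refine Finset.prod_congr rfl fun i _ => ?_
    split_ifs with h
    · rw [hy i h, had.1 i x x' y y']
      · intro j hj
        have : (j : ℕ) < i := hj
        exact hx j (by omega)
      · intro j hj
        have : (j : ℕ) < i := hj
        exact hy j (by omega)
    · rfl
  · refine Finset.prod_congr rfl fun i _ => ?_
    split_ifs with h
    · rw [hx i h, had.2 i x x' y y']
      · intro j hj
        have : (j : ℕ) < i := hj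
        exact hx j (by omega)
      · intro j hj
        have : (j : ℕ) ≤ i := hj
        exact hy j (by omega)
    · rfl

lemma fwd_x {n : ℕ} (pf pg : Fin n → (Fin n → Bool) → (Fin n → Bool) → ℝ) (c : ℝ)
    (had : Adapt pf pg) (ψ : (Fin n → Bool) → (Fin n → Bool) → ℝ) (k : Fin n)
    (ih : ∀ x y, dSum ψ ((k : ℕ) + 1) ((k : ℕ) + 1) x y =
      pProd pf pg c ((k : ℕ) + 1) ((k : ℕ) + 1) x y) (x y : Fin n → Bool) :
    dSum ψ k ((k : ℕ) + 1) x y = pProd pf pg c k ((k : ℕ) + 1) x y := by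
  have h1 : ∀ b, pProd pf pg c k ((k : ℕ) + 1) (Function.update x k b) y =
      pProd pf pg c k ((k : ℕ) + 1) x y := by
    intro b
    refine pProd_congr pf pg c had _ _ (by omega) (by omega) _ _ _ _ ?_ (fun _ _ => rfl)
    intro i hi
    exact Function.update_of_ne (by rintro rfl; omega) _ _
  have h2 : ∀ b, pg k (Function.update x k b) y = pg k x y := by
    intro b
    refine had.2 _ _ _ _ _ ?_ (fun _ _ => rfl)
    intro i hi
    exact Function.update_of_ne (ne_of_lt hi) _ _
  rw [dSum_splitx, ih, ih, pProd_stepg, pProd_stepg, h1, h1, h2, h2]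
  simp [bpow]
  ring

lemma fwd_y {n : ℕ} (pf pg : Fin n → (Fin n → Bool) → (Fin n → Bool) → ℝ) (c : ℝ)
    (had : Adapt pf pg) (ψ : (Fin n → Bool) → (Fin n → Bool) → ℝ) (k : Fin n)
    (ih : ∀ x y, dSum ψ k ((k : ℕ) + 1) x y =
      pProd pf pg c k ((k : ℕ) + 1) x y) (x y : Fin n → Bool) :
    dSum ψ k k x y = pProd pf pg c k k x y := by
  have h1 : ∀ b, pProd pf pg c k k x (Function.update y k b) =
      pProd pf pg c k k x y := by
    intro b
    refine pProd_congr pf pg c had _ _ (by omega) (by omega) _ _ _ _ (fun _ _ => rfl) ?_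
    intro i hi
    exact Function.update_of_ne (by rintro rfl; omega) _ _
  have h2 : ∀ b, pf k x (Function.update y k b) = pf k x y := by
    intro b
    refine had.1 _ _ _ _ _ (fun _ _ => rfl) ?_
    intro i hi
    exact Function.update_of_ne (ne_of_lt hi) _ _
  rw [dSum_splity, ih, ih, pProd_stepf, pProd_stepf, h1, h1, h2, h2]
  simp [bpow]
  ring

lemma fwd_all {n : ℕ} (pf pg : Fin n → (Fin n → Bool) → (Fin n → Bool) → ℝ) (c : ℝ)
    (had : Adapt pf pg) (ψ : (Fin n → Bool) → (Fin n → Bool) → ℝ)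
    (hψ : ∀ x y, ψ x y = pProd pf pg c n n x y) (d : ℕ) :
    ∀ k, k + d = n → ∀ x y, dSum ψ k k x y = pProd pf pg c k k x y := by
  induction d with
  | zero =>
    intro k hk x y
    obtain rfl : k = n := by omega
    rw [dSum_full, hψ]
  | succ d ih =>
    intro k hk
    have := ih (k + 1) (by omega)
    exact fwd_y pf pg c had ψ ⟨k, by omega⟩ (fwd_x pf pg c had ψ ⟨k, by omega⟩ this)

lemma fwd_IS3 {n : ℕ} (pf pg : Fin n → (Fin n → Bool) → (Fin n → Bool) → ℝ) (c : ℝ)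
    (had : Adapt pf pg) (ψ : (Fin n → Bool) → (Fin n → Bool) → ℝ)
    (hψ : ∀ x y, ψ x y = pProd pf pg c n n x y) (k : Fin n) (x y : Fin n → Bool) :
    dSum ψ k ((k : ℕ) + 1) x y = bpow (y k) (pf k x y) * dSum ψ k k x y := by
  rw [fwd_x pf pg c had ψ k (fwd_all pf pg c had ψ hψ (n - (k + 1)) _ (by omega)),
    fwd_all pf pg c had ψ hψ (n - k) _ (by omega), pProd_stepf]

lemma fwd_total {n : ℕ} (pf pg : Fin n → (Fin n → Bool) → (Fin n → Bool) → ℝ) (c : ℝ)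
    (had : Adapt pf pg) (ψ : (Fin n → Bool) → (Fin n → Bool) → ℝ)
    (hψ : ∀ x y, ψ x y = pProd pf pg c n n x y) :
    ∑ x, ∑ y, ψ x y = c := by
  rw [← dSum_zero ψ (fun _ => false) (fun _ => false),
    fwd_all pf pg c had ψ hψ n 0 (by omega)]
  simp [pProd]

lemma bwd_all {n : ℕ} (pf pg : Fin n → (Fin n → Bool) → (Fin n → Bool) → ℝ)
    (ψ : (Fin n → Bool) → (Fin n → Bool) → ℝ)
    (hf : ∀ (k : Fin n) x y, dSum ψ k ((k : ℕ) + 1) x y = bpow (y k) (pf k x y) * dSum ψ k k x y)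
    (hg : ∀ (k : Fin n) x y, dSum ψ ((k : ℕ) + 1) ((k : ℕ) + 1) x y =
      bpow (x k) (pg k x y) * dSum ψ k ((k : ℕ) + 1) x y) (x y : Fin n → Bool) :
    pProd pf pg (∑ x, ∑ y, ψ x y) n n x y = ψ x y := by
  have key : ∀ k, k ≤ n → pProd pf pg (∑ x, ∑ y, ψ x y) k k x y = dSum ψ k k x y := by
    intro k
    induction k with
    | zero =>
      intro _
      rw [dSum_zero]
      simp [pProd]
    | succ k ih =>
      intro hk
      have e1 := hf ⟨k, hk⟩ x y
      have e2 := hg ⟨k, hk⟩ x y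
      have e3 := pProd_stepf pf pg (∑ x, ∑ y, ψ x y) k ⟨k, hk⟩ x y
      have e4 := pProd_stepg pf pg (∑ x, ∑ y, ψ x y) (k + 1) ⟨k, hk⟩ x y
      have e5 := ih (by omega)
      simp only at e1 e2 e3 e4
      rw [e4, e3, e2, e1, e5]
  rw [key n le_rfl, dSum_full]

lemma prod_last (T : ℕ) (hT : 2 ≤ T) (h : Fin T → ℝ) :
    ∏ t, h t = (∏ i : Fin (T - 1), h ⟨i, by omega⟩) * h ⟨T - 1, by omega⟩ := by
  obtain ⟨n, rfl⟩ : ∃ n, T = n + 1 := ⟨T - 1, by omega⟩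
  exact Fin.prod_univ_castSucc h

lemma prod_first (T : ℕ) (hT : 2 ≤ T) (h : Fin T → ℝ) :
    ∏ t, h t = h ⟨0, by omega⟩ * (∏ i : Fin (T - 1), h ⟨i + 1, by omega⟩) := by
  obtain ⟨n, rfl⟩ : ∃ n, T = n + 1 := ⟨T - 1, by omega⟩
  exact Fin.prod_univ_succ h

/-- outcome probability -/
def pfM (T : ℕ) (F : ℝ → ℝ) (θ : ℝ) (x1 : Bool) (α : ℝ) :
    Fin (T - 1) → (Fin (T - 1) → Bool) → (Fin (T - 1) → Bool) → ℝ :=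
  fun i x _ => F (θ * bx (consPath (T := T) x1 x ⟨i, by omega⟩) + α)

/-- feedback probability -/
def pgM (T : ℕ) (S : Finset ℝ) (G : Feedback T S) (x1 : Bool) (α : ↥S) :
    Fin (T - 1) → (Fin (T - 1) → Bool) → (Fin (T - 1) → Bool) → ℝ :=
  fun i x y => G ⟨i + 1, by omega⟩ (restr (snocPath y false) _) (restr (consPath x1 x) _) α

lemma restr_snoc (T : ℕ) (y y' : Fin (T - 1) → Bool) (b b' : Bool) (i : Fin (T - 1))
    (h : ∀ j : Fin (T - 1), j ≤ i → y j = y' j) :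
    restr (T := T) (snocPath y b) ⟨i + 1, by omega⟩ = restr (snocPath y' b') ⟨i + 1, by omega⟩ := by
  funext j
  have hj : (j : ℕ) < i + 1 := j.isLt
  have hj2 : (j : ℕ) < T - 1 := by omega
  simp only [restr, snocPath, hj2, dif_pos]
  exact h _ (by rw [Fin.le_def]; simp only; omega)

lemma restr_cons (T : ℕ) (x x' : Fin (T - 1) → Bool) (x1 : Bool) (i : Fin (T - 1))
    (h : ∀ j : Fin (T - 1), j < i → x j = x' j) :
    restr (T := T) (consPath x1 x) ⟨i + 1, by omega⟩ = restr (consPath x1 x') ⟨i + 1, by omega⟩ := by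
  funext j
  have hj : (j : ℕ) < i + 1 := j.isLt
  simp only [restr, consPath]
  split_ifs with h0
  · rfl
  · exact h _ (by rw [Fin.lt_def]; simp only; omega)

lemma adapt_model (T : ℕ) (S : Finset ℝ) (F : ℝ → ℝ) (θ : ℝ) (G : Feedback T S) (x1 : Bool)
    (α : ↥S) : Adapt (pfM T F θ x1 α) (pgM T S G x1 α) := by
  constructor
  · intro i x x' y y' hx _
    simp only [pfM, consPath]
    split_ifs with h0
    · rfl
    · rw [hx _ (by rw [Fin.lt_def]; simp only; omega)]
  · intro i x x' y y' hx hy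
    simp only [pgM]
    rw [restr_snoc T y y' false false i hy, restr_cons T x x' x1 i hx]

lemma QT_eq (T : ℕ) [NeZero T] (hT : 2 ≤ T) (S : Finset ℝ) (F : ℝ → ℝ) (θ : ℝ)
    (π : Bool → ↥S → ℝ) (G : Feedback T S) (x1 : Bool) (yr : Fin (T - 1) → Bool) (yT : Bool)
    (xr : Fin (T - 1) → Bool) :
    QT T F S (θ, π, G) (snocPath yr yT) (consPath x1 xr) =
      ∑ α : ↥S, bpow yT (F (θ * bx (xr ⟨T - 2, by omega⟩) + ↑α)) *
        pProd (pfM T F θ x1 α) (pgM T S G x1 α) (π x1 α) (T - 1) (T - 1) xr yr := by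
  unfold QT
  refine Finset.sum_congr rfl fun α _ => ?_
  rw [prod_last T hT, prod_first T hT (fun t => if (t : ℕ) = 0 then 1 else _)]
  have h0 : consPath x1 xr (0 : Fin T) = x1 := by simp [consPath]
  have h1 : snocPath (T := T) yr yT ⟨T - 1, by omega⟩ = yT := by simp [snocPath]
  have h2 : consPath (T := T) x1 xr ⟨T - 1, by omega⟩ = xr ⟨T - 2, by omega⟩ := by
    have : T - 1 ≠ 0 := by omega
    simp only [consPath, this, dif_neg, not_false_iff]
    rfl
  simp only [h0, h1, h2]
  have e1 : (∏ i : Fin (T - 1), bpow (snocPath (T := T) yr yT ⟨i, by omega⟩)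
      (F (θ * bx (consPath (T := T) x1 xr ⟨i, by omega⟩) + ↑α))) =
      ∏ i : Fin (T - 1), if (i : ℕ) < T - 1 then bpow (yr i) (pfM T F θ x1 α i xr yr) else 1 := by
    refine Finset.prod_congr rfl fun i _ => ?_
    simp [snocPath, pfM]
  have e2 : (∏ i : Fin (T - 1), if (i : ℕ) + 1 = 0 then 1 else
      bpow (consPath (T := T) x1 xr ⟨i + 1, by omega⟩)
      (G ⟨i + 1, by omega⟩ (restr (snocPath yr yT) _) (restr (consPath x1 xr) _) α)) =
      ∏ i : Fin (T - 1), if (i : ℕ) < T - 1 then bpow (xr i) (pgM T S G x1 α i xr yr) else 1 := by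
    refine Finset.prod_congr rfl fun i _ => ?_
    rw [if_neg (by omega), if_pos i.isLt, pgM, restr_snoc T yr yr yT false i (fun _ _ => rfl)]
    simp [consPath]
  unfold pProd
  rw [← e1, ← e2]
  simp only [if_true]
  ring

/-- Extension of an outcome history. -/
def extY (T : ℕ) (t : ℕ) (yh : Fin t → Bool) : Fin (T - 1) → Bool :=
  fun i => if h : (i : ℕ) < t then yh ⟨i, h⟩ else false

/-- Extension of a covariate history by ones. -/
def extX (T : ℕ) (t : ℕ) (xh : Fin t → Bool) : Fin (T - 1) → Bool :=
  fun i => if h : (i : ℕ) + 1 < t then xh ⟨i + 1, h⟩ else true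

/-- The initial covariate of a history. -/
def ext1 (t : ℕ) (xh : Fin t → Bool) : Bool := if h : 0 < t then xh ⟨0, h⟩ else false

/-- Feedback process recovered from `ψ`. -/
def recG (T : ℕ) (S : Finset ℝ)
    (ψ : Bool → (Fin (T - 1) → Bool) → (Fin (T - 1) → Bool) → ↥S → ℝ) : Feedback T S :=
  fun t yh xh α =>
    dSum (fun x y => ψ (ext1 t xh) x y α) t t (extX T t xh) (extY T t yh) /
    dSum (fun x y => ψ (ext1 t xh) x y α) (t - 1) t (extX T t xh) (extY T t yh)

lemma recG_valid (T : ℕ) (S : Finset ℝ)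
    (ψ : Bool → (Fin (T - 1) → Bool) → (Fin (T - 1) → Bool) → ↥S → ℝ)
    (hψ : ∀ x1 xr yr α, 0 ≤ ψ x1 xr yr α) : ValidGT T S (recG T S ψ) := by
  intro t yh xh α
  constructor
  · exact div_nonneg (dSum_nonneg _ (fun _ _ => hψ _ _ _ _) _ _ _ _)
      (dSum_nonneg _ (fun _ _ => hψ _ _ _ _) _ _ _ _)
  · exact div_le_one_of_le₀ (dSum_anti _ (fun _ _ => hψ _ _ _ _) _ _ _ (by omega) _ _)
      (dSum_nonneg _ (fun _ _ => hψ _ _ _ _) _ _ _ _)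

lemma recG_step (T : ℕ) (S : Finset ℝ)
    (ψ : Bool → (Fin (T - 1) → Bool) → (Fin (T - 1) → Bool) → ↥S → ℝ)
    (hψ : ∀ x1 xr yr α, 0 ≤ ψ x1 xr yr α) (x1 : Bool) (α : ↥S) (k : Fin (T - 1))
    (x y : Fin (T - 1) → Bool) :
    dSum (fun x y => ψ x1 x y α) ((k : ℕ) + 1) ((k : ℕ) + 1) x y =
      bpow (x k) (pgM T S (recG T S ψ) x1 α k x y) *
        dSum (fun x y => ψ x1 x y α) k ((k : ℕ) + 1) x y := by
  have hG : pgM T S (recG T S ψ) x1 α k x y =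
      dSum (fun x y => ψ x1 x y α) ((k : ℕ) + 1) ((k : ℕ) + 1) (Function.update x k true) y /
      dSum (fun x y => ψ x1 x y α) k ((k : ℕ) + 1) x y := by
    have h1 : ext1 ((k : ℕ) + 1) (restr (T := T) (consPath x1 x) ⟨k + 1, by omega⟩) = x1 := by
      simp [ext1, restr, consPath]
    have hy : ∀ i : Fin (T - 1), (i : ℕ) < (k : ℕ) + 1 →
        extY T ((k : ℕ) + 1) (restr (T := T) (snocPath y false) ⟨k + 1, by omega⟩) i = y i := by
      intro i hi
      simp [extY, restr, snocPath, hi]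
    have hx : ∀ i : Fin (T - 1), (i : ℕ) < (k : ℕ) + 1 →
        extX T ((k : ℕ) + 1) (restr (T := T) (consPath x1 x) ⟨k + 1, by omega⟩) i =
          Function.update x k true i := by
      intro i hi
      by_cases hik : i = k
      · subst hik
        simp [extX]
      · have : (i : ℕ) ≠ k := fun h => hik (Fin.ext h)
        have h3 : (i : ℕ) < k := by omega
        rw [Function.update_of_ne hik]
        simp [extX, restr, consPath, h3]
    unfold pgM recG
    simp only [h1, Nat.add_sub_cancel]
    congr 1
    · exact dSum_congr _ _ _ _ _ _ _ hx hy
    · refine dSum_congr _ _ _ _ _ _ _ (fun i hi => ?_) hy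
      rw [hx i (by omega), Function.update_of_ne (by rintro rfl; omega)]
  have hs := dSum_splitx (fun x y => ψ x1 x y α) k ((k : ℕ) + 1) x y
  have n1 := dSum_nonneg (fun x y => ψ x1 x y α) (fun _ _ => hψ _ _ _ _) ((k : ℕ) + 1)
    ((k : ℕ) + 1) (Function.update x k true) y
  have n2 := dSum_nonneg (fun x y => ψ x1 x y α) (fun _ _ => hψ _ _ _ _) ((k : ℕ) + 1)
    ((k : ℕ) + 1) (Function.update x k false) y
  have hmul : dSum (fun x y => ψ x1 x y α) ((k : ℕ) + 1) ((k : ℕ) + 1)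
        (Function.update x k true) y =
      pgM T S (recG T S ψ) x1 α k x y * dSum (fun x y => ψ x1 x y α) k ((k : ℕ) + 1) x y := by
    rw [hG]
    by_cases h0 : dSum (fun x y => ψ x1 x y α) k ((k : ℕ) + 1) x y = 0
    · rw [h0, mul_zero]
      linarith
    · rw [div_mul_cancel₀ _ h0]
  have hup : Function.update x k (x k) = x := Function.update_eq_self k x
  cases hb : x k with
  | true =>
    rw [hb] at hup
    rw [hup] at hmul
    simpa [bpow] using hmul
  | false =>
    rw [hb] at hup
    rw [hup] at hs
    simp only [bpow, Bool.false_eq_true, if_false]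
    linarith

lemma bpow_nonneg (b : Bool) (p : ℝ) (hp : p ∈ Set.Icc (0 : ℝ) 1) : 0 ≤ bpow b p := by
  cases b
  · simpa [bpow] using hp.2
  · simpa [bpow] using hp.1

lemma pProd_nonneg {n : ℕ} (pf pg : Fin n → (Fin n → Bool) → (Fin n → Bool) → ℝ) (c : ℝ)
    (hf : ∀ i x y, pf i x y ∈ Set.Icc (0 : ℝ) 1) (hg : ∀ i x y, pg i x y ∈ Set.Icc (0 : ℝ) 1)
    (hc : 0 ≤ c) (a b : ℕ) (x y : Fin n → Bool) : 0 ≤ pProd pf pg c a b x y := by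
  refine mul_nonneg (mul_nonneg (Finset.prod_nonneg fun i _ => ?_)
    (Finset.prod_nonneg fun i _ => ?_)) hc
  · split_ifs
    · exact bpow_nonneg _ _ (hf _ _ _)
    · exact zero_le_one
  · split_ifs
    · exact bpow_nonneg _ _ (hg _ _ _)
    · exact zero_le_one

lemma path_y (T : ℕ) (hT : 2 ≤ T) (y : Fin T → Bool) :
    y = snocPath (fun i : Fin (T - 1) => y ⟨i, by omega⟩) (y ⟨T - 1, by omega⟩) := by
  funext t
  unfold snocPath
  split_ifs with h
  · rfl
  · congr 1
    apply Fin.ext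
    simp only
    omega

lemma path_x (T : ℕ) (hT : 2 ≤ T) (x : Fin T → Bool) :
    x = consPath (x ⟨0, by omega⟩) (fun i : Fin (T - 1) => x ⟨i + 1, by omega⟩) := by
  funext t
  unfold consPath
  split_ifs with h
  · congr 1
    exact Fin.ext h
  · congr 1
    apply Fin.ext
    simp only
    omega

lemma sum_swap_total {n : ℕ} (S : Finset ℝ) (ψ : (Fin n → Bool) → (Fin n → Bool) → ↥S → ℝ) :
    ∑ x, ∑ y, ∑ α : ↥S, ψ x y α = ∑ α : ↥S, ∑ x, ∑ y, ψ x y α := by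
  rw [Finset.sum_comm (s := (Finset.univ : Finset ↥S))]
  refine Finset.sum_congr rfl fun x _ => ?_
  rw [Finset.sum_comm]

lemma ape_swap (S : Finset ℝ) (q : Bool → ℝ) (d : ↥S → ℝ) (p : Bool → ↥S → ℝ) :
    ∑ x1 : Bool, q x1 * ∑ α : ↥S, d α * p x1 α = ∑ α : ↥S, d α * ∑ x1 : Bool, q x1 * p x1 α := by
  simp only [Finset.mul_sum]
  rw [Finset.sum_comm]
  refine Finset.sum_congr rfl fun α _ => Finset.sum_congr rfl fun x1 _ => ?_
  ring

/-- **Identified set for the average partial effect (equation (15) with Proposition 1)**: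
`Δ̃` lies in the identified set of the average partial effect
`Δ = Σ_{x₁} q_{x₁} Σ_α (F(θ+α) - F(α)) π_{x₁}(α)` if and only if there exist `θ̃ ∈ Θ`
and functions `ψ_{x₁}` satisfying (IS1)–(IS3) at `θ̃` together with the corresponding
linear representation of `Δ̃`. -/
theorem statement_17 (T : ℕ) [NeZero T] (hT : 2 ≤ T)
    (S : Finset ℝ) (F : ℝ → ℝ) (hF : ∀ u, F u ∈ Set.Icc (0:ℝ) 1)
    (Θ : Set ℝ)
    (θ : ℝ) (π : Bool → ↥S → ℝ) (G : Feedback T S)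
    (hπ : ValidPiT S π) (hG : ValidGT T S G)
    (q : Bool → ℝ) (hq : ∀ x1, 0 ≤ q x1) (hqsum : q false + q true = 1)
    (Δt : ℝ) :
    -- Δ̃ lies in the identified set of the average partial effect
    (∃ θ' ∈ Θ, ∃ πt Gt, ValidPiT S πt ∧ ValidGT T S Gt ∧
      QT T F S (θ', πt, Gt) = QT T F S (θ, π, G) ∧
      Δt = ∑ x1 : Bool, q x1 * ∑ α : ↥S, (F (θ' + ↑α) - F ↑α) * πt x1 α) ↔
    -- if and only if it admits the linear-programming representation
    (∃ θ' ∈ Θ, ∃ ψ : Bool → (Fin (T - 1) → Bool) → (Fin (T - 1) → Bool) → ↥S → ℝ,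
      PsiFeasible T hT S F θ π G θ' ψ ∧
      Δt = ∑ α : ↥S, (F (θ' + ↑α) - F ↑α) *
        ∑ x1 : Bool, q x1 * ∑ xr : Fin (T - 1) → Bool, ∑ yr : Fin (T - 1) → Bool,
          ψ x1 xr yr α) := by
  constructor
  · rintro ⟨θ', hθ', πt, Gt, hπt, hGt, hQ, hΔ⟩
    have htot : ∀ x1 (α : ↥S), ∑ xr, ∑ yr, pProd (pfM T F θ' x1 α) (pgM T S Gt x1 α) (πt x1 α)
        (T - 1) (T - 1) xr yr = πt x1 α := fun x1 α =>
      fwd_total _ _ _ (adapt_model T S F θ' Gt x1 α) _ (fun _ _ => rfl)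
    refine ⟨θ', hθ', fun x1 xr yr α => pProd (pfM T F θ' x1 α) (pgM T S Gt x1 α) (πt x1 α)
      (T - 1) (T - 1) xr yr, ⟨?_, ?_, ?_, ?_⟩, ?_⟩
    · intro x1 yr yT xr
      rw [← hQ, QT_eq T hT]
    · intro x1 xr yr α
      exact pProd_nonneg _ _ _ (fun _ _ _ => hF _) (fun _ _ _ => hGt _ _ _ _) (hπt.1 _ _) _ _ _ _
    · intro x1
      rw [sum_swap_total, ← hπt.2 x1]
      exact Finset.sum_congr rfl fun α _ => htot x1 α
    · intro s hs2 hsT α x1 xr yr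
      obtain ⟨k, rfl⟩ : ∃ k, s = k + 2 := ⟨s - 2, by omega⟩
      exact fwd_IS3 _ _ _ (adapt_model T S F θ' Gt x1 α) _ (fun _ _ => rfl)
        ⟨k, by omega⟩ xr yr
    · simp only [htot]
      rw [hΔ, ape_swap]
  · rintro ⟨θ', hθ', ψ, ⟨h1, h2, h3, h4⟩, hΔ⟩
    refine ⟨θ', hθ', fun x1 α => ∑ xr, ∑ yr, ψ x1 xr yr α, recG T S ψ, ⟨?_, ?_⟩,
      recG_valid T S ψ h2, ?_, ?_⟩
    · intro x1 α
      exact Finset.sum_nonneg fun _ _ => Finset.sum_nonneg fun _ _ => h2 _ _ _ _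
    · intro x1
      rw [← sum_swap_total, h3]
    · funext y x
      rw [path_y T hT y, path_x T hT x, QT_eq T hT, h1]
      refine Finset.sum_congr rfl fun α _ => ?_
      congr 1
      refine bwd_all _ _ (fun x y => ψ _ x y α) ?_ (recG_step T S ψ h2 _ α) _ _
      intro k xr yr
      exact h4 ((k : ℕ) + 2) (by omega) (by omega) α _ xr yr
    · rw [hΔ, ape_swap]
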